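/- Let $k$ be a field, $n\ge 1$ an integer, and $C,D>0$ real constants. For each $m\in\mathbb{Z}_{>0}$ let $V_m$ be a finite-dimensional $k$-vector space with $\dim_k V_m\le D m^n$, equipped with a decreasing family of subspaces $(\mathscr{F}^{\lambda}V_m)_{\lambda\in\mathbb{Z}}$ satisfying $\mathscr{F}^{\lambda}V_m=V_m$ for $\lambda\le -Cm$ and $\mathscr{F}^{\lambda}V_m=0$ for $\lambda\ge Cm$. Suppose that $v_0:=\lim_{m\to\infty}\dim_k V_m/m^n$ exists and that for Lebesgue-almost every $x\in(-C,C)$ the limit $v(x):=\lim_{m\to\infty}\dim_k\mathscr{F}^{\lceil mx\rceil}V_m/m^n$ exists. Then, with $w(m)=\sum_{\lambda\in\mathbb{Z}}\lambda\,(\dim_k\mathscr{F}^{\lambda}V_m-\dim_k\mathscr{F}^{\lambda+1}V_m)$, the limit $\lim_{m\to\infty} w(m)/m^{n+1}$ exists and equals $\int_{-C}^{C}v(x)\,dx - C\,v_0$. -/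

import Mathlib

open Filter MeasureTheory

/-- The weight `w = ∑_{λ ∈ ℤ} λ (dim 𝓕^λ V - dim 𝓕^{λ+1} V)` of a `ℤ`-indexed decreasing
family of subspaces of a vector space, expressed as a `finsum` over `ℤ`. -/
noncomputable def filtrationWeight (k : Type*) {V : Type*} [DivisionRing k] [AddCommGroup V]
    [Module k V] (F : ℤ → Submodule k V) : ℤ :=
  ∑ᶠ l : ℤ, l * ((Module.finrank k (F l) : ℤ) - (Module.finrank k (F (l + 1)) : ℤ))

/-- Summation by parts for a sequence indexed by an integer interval. -/
lemma sum_range_mul_sub_succ (f : ℤ → ℤ) (a : ℤ) (j : ℕ) :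
    ∑ i ∈ Finset.range j, (a + i) * (f (a + i) - f (a + i + 1)) =
      a * f a - (a + j) * f (a + j) + ∑ i ∈ Finset.range j, f (a + i + 1) := by
  induction j with
  | zero => simp
  | succ j ih =>
    rw [Finset.sum_range_succ, Finset.sum_range_succ, ih]
    push_cast
    rw [← add_assoc a]
    ring

lemma integral_comp_ceil {φ : ℤ → ℝ} (hφ : Antitone φ) (a : ℤ) (j : ℕ) :
    ∫ t in (a : ℝ)..(a + j), φ ⌈t⌉ = ∑ i ∈ Finset.range j, φ (a + i + 1) := by
  have hanti : Antitone fun t : ℝ => φ ⌈t⌉ := fun _ _ h => hφ (Int.ceil_mono h)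
  have hsum := intervalIntegral.sum_integral_adjacent_intervals (μ := volume)
    (f := fun t : ℝ => φ ⌈t⌉) (a := fun i : ℕ => (a : ℝ) + i) (n := j)
    fun _ _ => hanti.intervalIntegrable
  simp only [Nat.cast_zero, add_zero] at hsum
  rw [← hsum]
  refine Finset.sum_congr rfl fun i _ => ?_
  have hceil : ∀ t ∈ Set.uIoc ((a : ℝ) + i) (a + (i + 1 : ℕ)), φ ⌈t⌉ = φ (a + i + 1) := by
    intro t ht
    rw [Set.uIoc_of_le (by push_cast; linarith), Set.mem_Ioc] at ht
    congr 1
    rw [Int.ceil_eq_iff]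
    push_cast at ht ⊢
    constructor <;> linarith
  rw [intervalIntegral.integral_congr_ae (Eventually.of_forall hceil)]
  simp

lemma filtrationWeight_eq_integral {k V : Type*} [Field k] [AddCommGroup V] [Module k V]
    [FiniteDimensional k V] {F : ℤ → Submodule k V} (hF : Antitone F) (L : ℕ)
    (htop : ∀ l : ℤ, l ≤ -L → F l = ⊤) (hbot : ∀ l : ℤ, L ≤ l → F l = ⊥) :
    (filtrationWeight k F : ℝ) =
      -L * Module.finrank k V + ∫ t in (-L : ℝ)..L, (Module.finrank k (F ⌈t⌉) : ℝ) := by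
  have hinj : Set.InjOn (fun i : ℕ => -(L : ℤ) + i) (Finset.range (2 * L)) :=
    fun _ _ _ _ h => by simpa using h
  have hw : filtrationWeight k F = -L * (Module.finrank k V : ℤ) +
      ∑ i ∈ Finset.range (2 * L), (Module.finrank k (F (-L + i + 1)) : ℤ) := by
    rw [filtrationWeight, finsum_eq_sum_of_support_subset
      (s := (Finset.range (2 * L)).image fun i : ℕ => -(L : ℤ) + i), Finset.sum_image hinj,
      sum_range_mul_sub_succ (fun l => (Module.finrank k (F l) : ℤ)),
      htop _ le_rfl, hbot (-L + (2 * L : ℕ)) (by push_cast; linarith)]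
    · simp
    · intro l hl
      simp only [Finset.coe_image, Set.mem_image, Finset.coe_range, Set.mem_Iio]
      by_contra! hne
      apply hl
      beta_reduce
      rcases lt_or_ge l (-L) with h | h
      · rw [htop l h.le, htop (l + 1) h, sub_self, mul_zero]
      · have hL : (L : ℤ) ≤ l := by
          by_contra! hlt
          exact hne (l + L).toNat (by lia) (by lia)
        rw [hbot l hL, hbot (l + 1) (by lia), sub_self, mul_zero]
  have hφ : Antitone fun l => (Module.finrank k (F l) : ℝ) :=
    fun _ _ h => Nat.cast_le.mpr (Submodule.finrank_mono (hF h))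
  have hint := integral_comp_ceil hφ (-L) (2 * L)
  push_cast at hint
  rw [show -(L : ℝ) + 2 * L = L by ring] at hint
  rw [hint, hw]
  push_cast
  rfl

/-- The finite-level form of the limit formula, on an interval with integer endpoints. -/
lemma filtrationWeight_div_pow_eq {k V : Type*} [Field k] [AddCommGroup V] [Module k V]
    [FiniteDimensional k V] {F : ℤ → Submodule k V} (hF : Antitone F) {m : ℕ} (hm : 0 < m)
    (n K : ℕ) (htop : ∀ l : ℤ, l ≤ -(K * m : ℕ) → F l = ⊤)
    (hbot : ∀ l : ℤ, (K * m : ℕ) ≤ l → F l = ⊥) :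
    (filtrationWeight k F : ℝ) / (m : ℝ) ^ (n + 1) =
      (∫ x in (-K : ℝ)..K, (Module.finrank k (F ⌈m * x⌉) : ℝ) / (m : ℝ) ^ n) -
        K * (Module.finrank k V / (m : ℝ) ^ n) := by
  have hm' : (m : ℝ) ≠ 0 := by positivity
  have hscale := intervalIntegral.integral_comp_mul_left (a := (-K : ℝ)) (b := K)
    (fun t : ℝ => (Module.finrank k (F ⌈t⌉) : ℝ)) hm'
  rw [filtrationWeight_eq_integral hF _ htop hbot, intervalIntegral.integral_div, hscale,
    smul_eq_mul, mul_neg, mul_comm (m : ℝ) K]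
  push_cast
  field_simp
  ring

/-- For a sequence of linearly bounded filtered vector spaces `(V_m, 𝓕)` with
`dim V_m ≤ D m^n`, if `v₀ = lim dim V_m / m^n` exists and for a.e. `x ∈ (-C, C)` the limit
`v(x) = lim dim 𝓕^{⌈mx⌉} V_m / m^n` exists, then the normalized weights `w(m)/m^{n+1}`
converge to `∫_{-C}^{C} v(x) dx - C v₀`. -/
theorem tendsto_weight_div_pow
    {k : Type*} [Field k] (n : ℕ) (hn : 1 ≤ n) (C D : ℝ) (hC : 0 < C) (hD : 0 < D)
    (V : ℕ → Type*) [∀ m, AddCommGroup (V m)] [∀ m, Module k (V m)]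
    [∀ m, FiniteDimensional k (V m)]
    (F : ∀ m : ℕ, ℤ → Submodule k (V m))
    (hdim : ∀ m : ℕ, 0 < m → (Module.finrank k (V m) : ℝ) ≤ D * (m : ℝ) ^ n)
    (hdec : ∀ m : ℕ, ∀ l : ℤ, F m (l + 1) ≤ F m l)
    (htop : ∀ m : ℕ, 0 < m → ∀ l : ℤ, (l : ℝ) ≤ -C * (m : ℝ) → F m l = ⊤)
    (hbot : ∀ m : ℕ, 0 < m → ∀ l : ℤ, C * (m : ℝ) ≤ (l : ℝ) → F m l = ⊥)
    (v0 : ℝ)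
    (hv0 : Tendsto (fun m : ℕ => (Module.finrank k (V m) : ℝ) / (m : ℝ) ^ n) atTop (nhds v0))
    (v : ℝ → ℝ)
    (hv : ∀ᵐ x ∂(volume.restrict (Set.Ioo (-C) C)),
      Tendsto (fun m : ℕ => (Module.finrank k (F m ⌈(m : ℝ) * x⌉) : ℝ) / (m : ℝ) ^ n)
        atTop (nhds (v x))) :
    Tendsto (fun m : ℕ => (filtrationWeight k (F m) : ℝ) / (m : ℝ) ^ (n + 1)) atTop
      (nhds ((∫ x in Set.Ioo (-C) C, v x) - C * v0)) := by
  have hF : ∀ m, Antitone (F m) := fun m => antitone_int_of_succ_le (hdec m)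
  obtain ⟨K, hK⟩ := exists_nat_ge C
  set g : ℕ → ℝ → ℝ := fun m x => (Module.finrank k (F m ⌈(m : ℝ) * x⌉) : ℝ) / (m : ℝ) ^ n
    with hg
  have hanti : ∀ m, Antitone (g m) := fun m x y h => by
    have hle : ⌈(m : ℝ) * x⌉ ≤ ⌈(m : ℝ) * y⌉ := Int.ceil_mono (by gcongr)
    have hfin := Submodule.finrank_mono (hF m hle)
    simp only [hg]
    gcongr
  have hbound : ∀ m : ℕ, 0 < m → ∀ x, ‖g m x‖ ≤ D := fun m hm x => by
    have hmn : (0 : ℝ) < (m : ℝ) ^ n := by positivity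
    rw [Real.norm_of_nonneg (by positivity), div_le_iff₀ hmn]
    exact (Nat.cast_le.mpr (Submodule.finrank_le _)).trans (hdim m hm)
  have hlim : ∀ (a b : ℝ) (u : ℝ → ℝ),
      (∀ᵐ x, x ∈ Set.uIoc a b → Tendsto (fun m => g m x) atTop (nhds (u x))) →
      Tendsto (fun m => ∫ x in a..b, g m x) atTop (nhds (∫ x in a..b, u x)) := by
    intro a b u hu
    refine intervalIntegral.tendsto_integral_filter_of_dominated_convergence (fun _ => D)
      (Eventually.of_forall fun m => (hanti m).measurable.aestronglyMeasurable) ?_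
      intervalIntegrable_const hu
    filter_upwards [eventually_gt_atTop 0] with m hm
    exact Eventually.of_forall fun x _ => hbound m hm x
  have hleft : Tendsto (fun m => ∫ x in (-K : ℝ)..(-C), g m x) atTop
      (nhds (∫ _ in (-K : ℝ)..(-C), v0)) := by
    have hne : ∀ᵐ x : ℝ, x ≠ -C := by simp [ae_iff]
    refine hlim _ _ _ (hne.mono fun x hxC hx => hv0.congr' ?_)
    rw [Set.uIoc_of_le (by linarith)] at hx
    have hpos : 0 < -C - x := by linarith [lt_of_le_of_ne hx.2 hxC]
    obtain ⟨M, hM⟩ := exists_nat_ge (1 / (-C - x))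
    filter_upwards [eventually_gt_atTop 0, eventually_ge_atTop M] with m hm hMm
    have hgap : 1 ≤ (m : ℝ) * (-C - x) :=
      (div_le_iff₀ hpos).mp (hM.trans (Nat.cast_le.mpr hMm))
    have hle : (⌈(m : ℝ) * x⌉ : ℝ) ≤ -C * m := by
      linarith [Int.ceil_lt_add_one ((m : ℝ) * x)]
    simp only [hg]
    rw [htop m hm _ hle, finrank_top]
  have hmid : Tendsto (fun m => ∫ x in (-C)..C, g m x) atTop
      (nhds (∫ x in (-C)..C, v x)) := by
    refine hlim _ _ _ ?_
    rw [Set.uIoc_of_le (by linarith), ← ae_restrict_iff' measurableSet_Ioc,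
      ← restrict_Ioo_eq_restrict_Ioc]
    exact hv
  have hright : Tendsto (fun m => ∫ x in C..(K : ℝ), g m x) atTop
      (nhds (∫ _ in C..(K : ℝ), 0)) := by
    refine hlim _ _ _ (Eventually.of_forall fun x hx => tendsto_const_nhds.congr' ?_)
    rw [Set.uIoc_of_le hK] at hx
    filter_upwards [eventually_gt_atTop 0] with m hm
    have hle : C * (m : ℝ) ≤ (⌈(m : ℝ) * x⌉ : ℝ) := by
      refine le_trans ?_ (Int.le_ceil _)
      rw [mul_comm]
      gcongr
      exact hx.1.le
    simp only [hg]
    rw [hbot m hm _ hle, finrank_bot, Nat.cast_zero, zero_div]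
  have htotal := ((hleft.add hmid).add hright).sub (hv0.const_mul (K : ℝ))
  have hval : (∫ _ in (-K : ℝ)..(-C), v0) + (∫ x in (-C)..C, v x) + (∫ _ in C..(K : ℝ), 0) -
      K * v0 = (∫ x in Set.Ioo (-C) C, v x) - C * v0 := by
    rw [intervalIntegral.integral_of_le (by linarith : -C ≤ C), integral_Ioc_eq_integral_Ioo]
    simp
    ring
  rw [hval] at htotal
  refine htotal.congr' ?_
  filter_upwards [eventually_gt_atTop 0] with m hm
  have hKm : C * (m : ℝ) ≤ K * m := by gcongr
  have hint : ∀ a b : ℝ, IntervalIntegrable (g m) volume a b :=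
    fun _ _ => (hanti m).intervalIntegrable
  rw [intervalIntegral.integral_add_adjacent_intervals (hint _ _) (hint _ _),
    intervalIntegral.integral_add_adjacent_intervals (hint _ _) (hint _ _),
    filtrationWeight_div_pow_eq (hF m) hm n K]
  · intro l hl
    refine htop m hm l ?_
    have : (l : ℝ) ≤ -((K * m : ℕ) : ℝ) := by exact_mod_cast hl
    push_cast at this
    linarith
  · intro l hl
    refine hbot m hm l ?_
    have : ((K * m : ℕ) : ℝ) ≤ l := by exact_mod_cast hl
    push_cast at this
    linarith
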